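/- There exists a constant C > 0 such that for every finite strongly connected directed graph G = (V,E) on n ≥ 2 vertices with orbit b = b(G) and φ' = min(φ_out(G), φ_in(G)), and every valuation f : V → {1,…,n}, the expected convergence time of the asynchronous maximum model satisfies T(G,f) ≤ C·(n·b² + (n/φ')·log n). In particular the convergence time 𝒯(G) is O(n·b² + (n/φ')·log n). -/

import Mathlib

open MeasureTheory
open scoped ENNReal

attribute [local instance] Classical.propDecidable

/-- The out-neighbours of `v` in the directed graph with edge relation `E`, as a finset. -/
noncomputable def outNbrs {V : Type*} [Fintype V] (E : V → V → Prop) (v : V) : Finset V :=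
  Finset.univ.filter (fun u => E v u)

/-- The asynchronous maximum update of a valuation `f` at the vertex `v` in a directed graph:
the value at `v` is replaced by the maximum of `f` over the out-neighbours of `v` (if `v` has
at least one out-neighbour; otherwise nothing changes), and all other values are unchanged. -/
noncomputable def dUpdate {V : Type*} [Fintype V] (E : V → V → Prop)
    (f : V → ℕ) (v : V) : V → ℕ :=
  fun u => if u = v ∧ (outNbrs E v).Nonempty then (outNbrs E v).sup f else f u

/-- The asynchronous maximum model on a directed graph: starting from the valuation `f`, at
round `t` the vertex `ω t` is chosen and updated.  `dRun E f ω t` is the valuation after `t`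
rounds. -/
noncomputable def dRun {V : Type*} [Fintype V] (E : V → V → Prop)
    (f : V → ℕ) (ω : ℕ → V) : ℕ → V → ℕ
  | 0 => f
  | (t + 1) => dUpdate E (dRun E f ω t) (ω t)

/-- `μ` is the infinite product of uniform measures on `V`: a probability measure on `ℕ → V`
under which the coordinates are independent and uniformly distributed on `V`, i.e. every
cylinder fixing the first `m` coordinates has measure `(1/|V|)^m`. -/
def IsUniformProduct {V : Type*} [Fintype V] [MeasurableSpace V]
    (μ : Measure (ℕ → V)) : Prop :=
  IsProbabilityMeasure μ ∧
    ∀ (m : ℕ) (g : ℕ → V),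
      μ {ω | ∀ i < m, ω i = g i} = (1 / (Fintype.card V : ℝ≥0∞)) ^ m

/-- The orbit `b(G)` of a directed graph: the maximum over all vertices `x` of the length of a
shortest directed cycle through `x` (a cycle being a nonempty list of distinct vertices
`v :: l` with consecutive edges and an edge from the last vertex back to `v`, of length
`l.length + 1`). -/
noncomputable def orbit {V : Type*} [Fintype V] (E : V → V → Prop) : ℕ :=
  Finset.univ.sup fun x =>
    sInf {k : ℕ | ∃ (v : V) (l : List V), (v :: l).Nodup ∧ List.Chain E v (l ++ [v]) ∧
      x ∈ v :: l ∧ k = l.length + 1}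

/-- The out-boundary of a finset `A` in a directed graph with edge relation `E`:
the vertices outside `A` receiving an edge from `A`. -/
noncomputable def outBoundary {V : Type*} [Fintype V] (E : V → V → Prop)
    (A : Finset V) : Finset V :=
  Finset.univ.filter (fun v => v ∉ A ∧ ∃ u ∈ A, E u v)

/-- The outward vertex expansion `φ_out(G)`: the minimum of `|Γ(A)|/|A|` over all nonempty
vertex sets `A` with `|A| ≤ n/2`. -/
noncomputable def phiOut {V : Type*} [Fintype V] (E : V → V → Prop) : ℝ :=
  sInf {r : ℝ | ∃ A : Finset V, A.Nonempty ∧ 2 * A.card ≤ Fintype.card V ∧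
    r = (outBoundary E A).card / A.card}

/-- The inward vertex expansion `φ_in(G)`: the outward vertex expansion of the graph obtained
by reversing every edge. -/
noncomputable def phiIn {V : Type*} [Fintype V] (E : V → V → Prop) : ℝ :=
  phiOut (fun a b => E b a)

/-- The convergence time along the update sequence `ω`: the least `t` such that the valuation
after `t` rounds is constant, and `∞` if no such `t` exists (as a value in `ℝ≥0∞`). -/
noncomputable def dConvTime {V : Type*} [Fintype V] (E : V → V → Prop)
    (f : V → ℕ) (ω : ℕ → V) : ℝ≥0∞ :=
  ⨅ (t : ℕ) (_ : ∃ c : ℕ, dRun E f ω t = fun _ => c), (t : ℝ≥0∞)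

section Probability

variable {V : Type*} [Fintype V] (E : V → V → Prop)

/-- The probability that the valuation is not constant after `t` uniformly random rounds. -/
noncomputable def probNonconst : ℕ → (V → ℕ) → ℝ
  | 0, f => if ∃ c : ℕ, f = fun _ => c then 0 else 1
  | t + 1, f => (∑ v, probNonconst t (dUpdate E f v)) / Fintype.card V

/-- The expected number of the first `m` times at which the valuation is not constant. -/
noncomputable def truncTime (m : ℕ) (f : V → ℕ) : ℝ :=
  ∑ t ∈ Finset.range m, probNonconst E t f

lemma probNonconst_nonneg (t : ℕ) (f : V → ℕ) : 0 ≤ probNonconst E t f := by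
  induction t generalizing f with
  | zero => unfold probNonconst; split_ifs <;> simp
  | succ t ih =>
    unfold probNonconst
    exact div_nonneg (Finset.sum_nonneg fun v _ => ih _) (by positivity)

lemma truncTime_succ (m : ℕ) (f : V → ℕ) :
    truncTime E (m + 1) f =
      probNonconst E 0 f + (∑ v, truncTime E m (dUpdate E f v)) / Fintype.card V := by
  simp only [truncTime]
  rw [Finset.sum_range_succ', add_comm, Finset.sum_comm, Finset.sum_div]
  rfl

lemma dRun_congr (f : V → ℕ) {ω ω' : ℕ → V} {t : ℕ} (h : ∀ i < t, ω i = ω' i) :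
    dRun E f ω t = dRun E f ω' t := by
  induction t with
  | zero => rfl
  | succ t ih =>
    simp only [dRun]
    rw [ih fun i hi => h i (by omega), h t (by omega)]

lemma dRun_succ_eq (f : V → ℕ) (ω : ℕ → V) (t : ℕ) :
    dRun E f ω (t + 1) = dRun E (dUpdate E f (ω 0)) (fun i => ω (i + 1)) t := by
  induction t with
  | zero => rfl
  | succ t ih => rw [dRun, ih, dRun]

/-- Extend a finite word of vertices by a default vertex. -/
noncomputable def extendWord (v₀ : V) {t : ℕ} (g : Fin t → V) : ℕ → V :=
  fun i => if h : i < t then g ⟨i, h⟩ else v₀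

lemma sum_words_nonconst (v₀ : V) (t : ℕ) (f : V → ℕ) :
    (∑ g : Fin t → V,
        if ∃ c : ℕ, dRun E f (extendWord v₀ g) t = fun _ => c then (0 : ℝ) else 1) =
      (Fintype.card V : ℝ) ^ t * probNonconst E t f := by
  have : Nonempty V := ⟨v₀⟩
  have hc : (Fintype.card V : ℝ) ≠ 0 := by
    exact_mod_cast Fintype.card_ne_zero
  induction t generalizing f with
  | zero =>
    simp only [dRun, probNonconst, Finset.univ_unique, Finset.sum_singleton, pow_zero, one_mul]
    congr
  | succ t ih =>
    rw [← (Fin.consEquiv fun _ => V).sum_comp, Fintype.sum_prod_type]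
    have key : ∀ (v : V) (g : Fin t → V),
        dRun E f (extendWord v₀ (Fin.consEquiv (fun _ => V) (v, g))) (t + 1) =
          dRun E (dUpdate E f v) (extendWord v₀ g) t := by
      intro v g
      rw [dRun_succ_eq]
      have h0 : extendWord v₀ (Fin.consEquiv (fun _ => V) (v, g)) 0 = v := by
        simp [extendWord, Fin.consEquiv]
      rw [h0]
      apply dRun_congr
      intro i hi
      simp only [extendWord, Fin.consEquiv, Equiv.coe_fn_mk, hi, dif_pos,
        Nat.succ_lt_succ hi]
      exact Fin.cons_succ (α := fun _ => V) v g ⟨i, hi⟩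
    simp_rw [key, ih, ← Finset.mul_sum, probNonconst]
    field_simp
    ring

lemma preimage_restrict_nonconst (v₀ : V) (f : V → ℕ) (t : ℕ) :
    {ω : ℕ → V | ¬ ∃ c : ℕ, dRun E f ω t = fun _ => c} =
      (fun (ω : ℕ → V) (i : Fin t) => ω i) ⁻¹'
        ((Finset.univ.filter fun g : Fin t → V =>
          ¬ ∃ c : ℕ, dRun E f (extendWord v₀ g) t = fun _ => c : Finset (Fin t → V)) :
          Set (Fin t → V)) := by
  ext ω
  have : dRun E f ω t = dRun E f (extendWord v₀ fun i : Fin t => ω i) t :=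
    dRun_congr E f fun i hi => by simp [extendWord, hi]
  simp [this]

lemma dConvTime_le_tsum (f : V → ℕ) (ω : ℕ → V) :
    dConvTime E f ω ≤
      ∑' t : ℕ, {ω : ℕ → V | ¬ ∃ c : ℕ, dRun E f ω t = fun _ => c}.indicator 1 ω := by
  by_cases h : ∃ t, ∃ c : ℕ, dRun E f ω t = fun _ => c
  · refine (iInf₂_le (Nat.find h) (Nat.find_spec h)).trans ?_
    refine le_trans (le_of_eq ?_) (ENNReal.sum_le_tsum (Finset.range (Nat.find h)))
    rw [Finset.sum_congr rfl fun t ht => Set.indicator_of_mem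
      (Nat.find_min h (Finset.mem_range.1 ht)) _]
    simp
  · push Not at h
    have : ∀ t : ℕ,
        {ω : ℕ → V | ¬ ∃ c : ℕ, dRun E f ω t = fun _ => c}.indicator
          (1 : (ℕ → V) → ℝ≥0∞) ω = 1 :=
      fun t => Set.indicator_of_mem (show ω ∈ {ω : ℕ → V | _} from not_exists.2 (h t)) _
    rw [tsum_congr this, ENNReal.tsum_const_eq_top_of_ne_zero one_ne_zero]
    exact le_top

variable [MeasurableSpace V] [MeasurableSingletonClass V]

lemma measurableSet_nonconst (v₀ : V) (f : V → ℕ) (t : ℕ) :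
    MeasurableSet {ω : ℕ → V | ¬ ∃ c : ℕ, dRun E f ω t = fun _ => c} := by
  rw [preimage_restrict_nonconst E v₀]
  exact (measurable_pi_lambda _ fun i => measurable_pi_apply _) (Finset.measurableSet _)

lemma measure_nonconst (v₀ : V) {μ : Measure (ℕ → V)} (hμ : IsUniformProduct μ)
    (f : V → ℕ) (t : ℕ) :
    μ {ω : ℕ → V | ¬ ∃ c : ℕ, dRun E f ω t = fun _ => c} =
      ENNReal.ofReal (probNonconst E t f) := by
  have : Nonempty V := ⟨v₀⟩
  have hc : (0 : ℝ) < Fintype.card V := by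
    exact_mod_cast Fintype.card_pos
  have hm : Measurable fun (ω : ℕ → V) (i : Fin t) => ω i :=
    measurable_pi_lambda _ fun i => measurable_pi_apply _
  have hcyl : ∀ g : Fin t → V, μ ((fun (ω : ℕ → V) (i : Fin t) => ω i) ⁻¹' {g}) =
      ENNReal.ofReal ((1 / (Fintype.card V : ℝ)) ^ t) := by
    intro g
    have hset : (fun (ω : ℕ → V) (i : Fin t) => ω i) ⁻¹' {g} =
        {ω | ∀ i < t, ω i = extendWord v₀ g i} := by
      ext ω
      simp only [Set.mem_preimage, Set.mem_singleton_iff, Set.mem_ofPred_eq, funext_iff,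
        extendWord]
      constructor
      · intro h i hi
        simpa [hi] using h ⟨i, hi⟩
      · intro h i
        simpa using h i i.2
    rw [hset, hμ.2, ENNReal.ofReal_pow (by positivity), ENNReal.ofReal_div_of_pos hc]
    simp
  rw [preimage_restrict_nonconst E v₀,
    ← sum_measure_preimage_singleton _ fun g _ => hm (measurableSet_singleton g)]
  simp_rw [hcyl]
  rw [← ENNReal.ofReal_sum_of_nonneg fun _ _ => by positivity]
  congr 1
  have h := sum_words_nonconst E v₀ t f
  have h2 : (∑ g : Fin t → V,
        if ∃ c : ℕ, dRun E f (extendWord v₀ g) t = fun _ => c then (0 : ℝ) else 1) =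
      ((Finset.univ.filter fun g : Fin t → V =>
          ¬ ∃ c : ℕ, dRun E f (extendWord v₀ g) t = fun _ => c).card : ℝ) := by
    rw [Finset.card_filter]
    push_cast
    refine Finset.sum_congr rfl fun g _ => ?_
    by_cases hg : ∃ c : ℕ, dRun E f (extendWord v₀ g) t = fun _ => c <;> simp [hg]
  rw [Finset.sum_const, nsmul_eq_mul, ← h2, h, one_div, inv_pow]
  field_simp

lemma lintegral_dConvTime_le [Nonempty V] {μ : Measure (ℕ → V)} (hμ : IsUniformProduct μ)
    {f : V → ℕ} {B : ℝ} (hB : ∀ m, truncTime E m f ≤ B) :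
    ∫⁻ ω, dConvTime E f ω ∂μ ≤ ENNReal.ofReal B := by
  obtain ⟨v₀⟩ := ‹Nonempty V›
  refine (lintegral_mono (dConvTime_le_tsum E f)).trans ?_
  rw [lintegral_tsum fun t =>
    (measurable_one.indicator (measurableSet_nonconst E v₀ f t)).aemeasurable]
  simp_rw [lintegral_indicator_one (measurableSet_nonconst E v₀ f _),
    measure_nonconst E v₀ hμ]
  refine ENNReal.tsum_le_of_sum_range_le fun m => ?_
  rw [← ENNReal.ofReal_sum_of_nonneg fun t _ => probNonconst_nonneg E t f]
  exact ENNReal.ofReal_le_ofReal (hB m)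

end Probability

section Cycles

variable {V : Type*} {E : V → V → Prop}

/-- `C` is the vertex set of a directed cycle on which `σ` is the successor map. -/
structure IsOrientedCycle (E : V → V → Prop) (C : Finset V) (σ : Equiv.Perm V) : Prop where
  mem : ∀ x ∈ C, σ x ∈ C
  edge : ∀ x ∈ C, E x (σ x)
  eq_of_closed : ∀ B ⊆ C, B.Nonempty → (∀ x ∈ B, σ x ∈ B) → B = C

lemma exists_nodup_chain {x y : V} (h : Relation.ReflTransGen E x y) :
    ∃ l : List V, (x :: l).Nodup ∧ List.IsChain E (x :: l) ∧
      (x :: l).getLast (List.cons_ne_nil _ _) = y := by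
  induction h using Relation.ReflTransGen.head_induction_on with
  | refl => exact ⟨[], by simp⟩
  | @head a c hac _ ih =>
    obtain ⟨l, hnd, hch, hlast⟩ := ih
    by_cases ha : a ∈ c :: l
    · obtain ⟨s, t, hst⟩ := List.append_of_mem ha
      refine ⟨t, ?_, ?_, ?_⟩
      · rw [hst] at hnd
        exact (List.nodup_append.1 hnd).2.1
      · rw [hst] at hch
        exact (List.isChain_append.1 hch).2.1
      · rw [← hlast]
        simp [hst]
    · exact ⟨c :: l, List.nodup_cons.2 ⟨ha, hnd⟩, List.isChain_cons_cons.2 ⟨hac, hch⟩,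
        by simpa using hlast⟩

lemma exists_edge [Nontrivial V] (hE : ∀ u v : V, Relation.ReflTransGen E u v) (x : V) :
    ∃ y, E x y := by
  obtain ⟨z, hz⟩ := exists_ne x
  rcases (hE x z).cases_head with h | ⟨y, hy, -⟩
  · exact absurd h.symm hz
  · exact ⟨y, hy⟩

lemma exists_simple_cycle [Nontrivial V] (hE : ∀ u v : V, Relation.ReflTransGen E u v)
    (x : V) :
    ∃ (v : V) (l : List V), (v :: l).Nodup ∧ List.IsChain E (v :: (l ++ [v])) ∧ x ∈ v :: l := by
  obtain ⟨y, hy⟩ := exists_edge hE x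
  obtain ⟨l, hnd, hch, hlast⟩ := exists_nodup_chain (hE y x)
  refine ⟨y, l, hnd, ?_, hlast ▸ List.getLast_mem _⟩
  change List.IsChain E ((y :: l) ++ [y])
  refine List.isChain_append.2 ⟨hch, by simp, ?_⟩
  intro a ha b hb
  rw [List.getLast?_eq_getLast_of_ne_nil (List.cons_ne_nil _ _), hlast] at ha
  simp at ha hb
  subst ha hb
  exact hy

lemma isOrientedCycle_toFinset {v : V} {l : List V} (hnd : (v :: l).Nodup)
    (hch : List.IsChain E (v :: (l ++ [v]))) :
    IsOrientedCycle E (v :: l).toFinset (v :: l).formPerm where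
  mem x hx := by
    rw [List.mem_toFinset] at hx ⊢
    exact List.formPerm_apply_mem_of_mem hx
  edge x hx := by
    rw [List.mem_toFinset] at hx
    obtain ⟨i, hi, rfl⟩ := List.getElem_of_mem hx
    rw [List.formPerm_apply_getElem _ hnd]
    have hch' : List.IsChain E ((v :: l) ++ [v]) := hch
    have h := List.isChain_iff_getElem.1 hch' i (by simpa using hi)
    rw [List.getElem_append_left hi] at h
    by_cases hi' : i + 1 < (v :: l).length
    · rw [List.getElem_append_left hi'] at h
      simpa only [Nat.mod_eq_of_lt hi'] using h
    · have he : i + 1 = (v :: l).length := by omega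
      rw [List.getElem_append_right (by omega)] at h
      simpa [he] using h
  eq_of_closed B hB hne hcl := by
    obtain ⟨x, hx⟩ := hne
    have hpow : ∀ k : ℕ, ((v :: l).formPerm ^ k) x ∈ B := by
      intro k
      induction k with
      | zero => simpa using hx
      | succ k ih =>
        rw [pow_succ', Equiv.Perm.mul_apply]
        exact hcl _ ih
    obtain ⟨i, hi, rfl⟩ := List.getElem_of_mem (List.mem_toFinset.1 (hB hx))
    refine Finset.Subset.antisymm hB fun y hy => ?_
    obtain ⟨j, hj, rfl⟩ := List.getElem_of_mem (List.mem_toFinset.1 hy)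
    have h := hpow (j + ((v :: l).length - i))
    rw [List.formPerm_pow_apply_getElem _ hnd] at h
    have he : (i + (j + ((v :: l).length - i))) % (v :: l).length = j := by
      rw [show i + (j + ((v :: l).length - i)) = j + (v :: l).length by omega,
        Nat.add_mod_right, Nat.mod_eq_of_lt hj]
    simpa only [he] using h

/-- A set meeting a directed cycle properly is entered and left equally often along the cycle,
and at least once. -/
lemma IsOrientedCycle.card_enter_eq_card_leave {C : Finset V} {σ : Equiv.Perm V}
    (hC : IsOrientedCycle E C σ) (A : Finset V) :
    (C.filter fun c => c ∉ A ∧ σ c ∈ A).card = (C.filter fun c => c ∈ A ∧ σ c ∉ A).card := by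
  have h1 : (C.filter fun c => σ c ∈ A).card = (C.filter fun c => c ∈ A).card := by
    have himg : C.image σ = C :=
      Finset.eq_of_subset_of_card_le (Finset.image_subset_iff.2 hC.mem)
        (Finset.card_image_of_injective C σ.injective).ge
    conv_rhs => rw [← himg, Finset.filter_image]
    rw [Finset.card_image_of_injective _ σ.injective]
  have h2 := Finset.card_filter_add_card_filter_not (s := C.filter fun c => σ c ∈ A)
    (fun c => c ∈ A)
  have h3 := Finset.card_filter_add_card_filter_not (s := C.filter fun c => c ∈ A)
    (fun c => σ c ∈ A)
  rw [Finset.filter_filter, Finset.filter_filter] at h2 h3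
  simp only [and_comm] at h1 h2 h3 ⊢
  omega

lemma IsOrientedCycle.card_leave_pos {C : Finset V} {σ : Equiv.Perm V}
    (hC : IsOrientedCycle E C σ) {A : Finset V} (h0 : (C.filter fun c => c ∈ A).Nonempty)
    (h1 : C.filter (fun c => c ∈ A) ≠ C) :
    0 < (C.filter fun c => c ∈ A ∧ σ c ∉ A).card := by
  by_contra h
  refine h1 (hC.eq_of_closed _ (Finset.filter_subset _ _) h0 fun x hx => ?_)
  rw [Nat.pos_iff_ne_zero, not_not, Finset.card_eq_zero] at h
  rw [Finset.mem_filter] at hx ⊢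
  refine ⟨hC.mem x hx.1, ?_⟩
  by_contra hσ
  exact absurd (Finset.mem_filter.2 ⟨hx.1, hx.2, hσ⟩ : x ∈ C.filter fun c => c ∈ A ∧ σ c ∉ A)
    (by simp [h])

variable [Fintype V]

lemma exists_isOrientedCycle [Nontrivial V]
    (hE : ∀ u v : V, Relation.ReflTransGen E u v) (x : V) :
    ∃ C σ, IsOrientedCycle E C σ ∧ x ∈ C ∧ C.card ≤ orbit E := by
  set K : Set ℕ := {k : ℕ | ∃ (v : V) (l : List V), (v :: l).Nodup ∧
    List.IsChain E (v :: (l ++ [v])) ∧ x ∈ v :: l ∧ k = l.length + 1} with hK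
  have hne : K.Nonempty := by
    obtain ⟨v, l, h1, h2, h3⟩ := exists_simple_cycle hE x
    exact ⟨_, v, l, h1, h2, h3, rfl⟩
  obtain ⟨v, l, h1, h2, h3, h4⟩ := Nat.sInf_mem hne
  refine ⟨_, _, isOrientedCycle_toFinset h1 h2, List.mem_toFinset.2 h3, ?_⟩
  rw [List.toFinset_card_of_nodup h1, List.length_cons, ← h4]
  exact Finset.le_sup (f := fun x => sInf {k : ℕ | ∃ (v : V) (l : List V), (v :: l).Nodup ∧
    List.IsChain E (v :: (l ++ [v])) ∧ x ∈ v :: l ∧ k = l.length + 1}) (Finset.mem_univ x)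

end Cycles

section Expansion

variable {V : Type*} [Fintype V] {E : V → V → Prop}

lemma finite_expansionRatios (E : V → V → Prop) :
    {r : ℝ | ∃ A : Finset V, A.Nonempty ∧ 2 * A.card ≤ Fintype.card V ∧
      r = (outBoundary E A).card / A.card}.Finite :=
  (Set.finite_range fun A : Finset V => ((outBoundary E A).card / A.card : ℝ)).subset (by
    rintro r ⟨A, -, -, rfl⟩
    exact ⟨A, rfl⟩)

lemma phiOut_mul_card_le (E : V → V → Prop) {A : Finset V} (hA : A.Nonempty)
    (h : 2 * A.card ≤ Fintype.card V) : phiOut E * A.card ≤ (outBoundary E A).card := by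
  rw [← le_div_iff₀ (by exact_mod_cast hA.card_pos)]
  exact csInf_le (finite_expansionRatios E).bddBelow ⟨A, hA, h, rfl⟩

lemma outBoundary_nonempty (hE : ∀ u v : V, Relation.ReflTransGen E u v) {A : Finset V}
    (hA : A.Nonempty) (hA' : A ≠ Finset.univ) : (outBoundary E A).Nonempty := by
  by_contra h
  rw [Finset.not_nonempty_iff_eq_empty] at h
  obtain ⟨x, hx⟩ := hA
  refine hA' (Finset.eq_univ_iff_forall.2 fun y => ?_)
  induction hE x y with
  | refl => exact hx
  | @tail b c _ hbc ih =>
    by_contra hc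
    have : c ∈ outBoundary E A := Finset.mem_filter.2 ⟨Finset.mem_univ _, hc, b, ih, hbc⟩
    simp [h] at this

lemma phiOut_pos [Nontrivial V] (hE : ∀ u v : V, Relation.ReflTransGen E u v) :
    0 < phiOut E := by
  have hcard := Fintype.one_lt_card (α := V)
  obtain ⟨x⟩ : Nonempty V := inferInstance
  have hne : {r : ℝ | ∃ A : Finset V, A.Nonempty ∧ 2 * A.card ≤ Fintype.card V ∧
      r = (outBoundary E A).card / A.card}.Nonempty :=
    ⟨_, {x}, Finset.singleton_nonempty x, by rw [Finset.card_singleton]; omega, rfl⟩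
  obtain ⟨A, hA, hA2, hr⟩ := hne.csInf_mem (finite_expansionRatios E)
  rw [phiOut, hr]
  have hA' : A ≠ Finset.univ := by
    rintro rfl
    rw [Finset.card_univ] at hA2
    omega
  have h1 := (outBoundary_nonempty hE hA hA').card_pos
  have h2 := hA.card_pos
  positivity

lemma phiOut_le_two [Nontrivial V] (E : V → V → Prop) : phiOut E ≤ 2 := by
  have hcard := Fintype.one_lt_card (α := V)
  obtain ⟨A, -, hA⟩ := Finset.exists_subset_card_eq (s := (Finset.univ : Finset V))
    (n := Fintype.card V / 2) (by rw [Finset.card_univ]; omega)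
  have hpos : 0 < A.card := by omega
  have h1 := phiOut_mul_card_le E (Finset.card_pos.1 hpos) (by omega)
  have h2 : outBoundary E A ⊆ Aᶜ := fun v hv => by
    simpa using (Finset.mem_filter.1 hv).2.1
  have h3 := Finset.card_le_card h2
  rw [Finset.card_compl] at h3
  have h4 : ((outBoundary E A).card : ℝ) ≤ 2 * A.card := by
    exact_mod_cast (by omega : (outBoundary E A).card ≤ 2 * A.card)
  have h5 : (0 : ℝ) < A.card := by exact_mod_cast hpos
  nlinarith

/-- The vertices outside `S` with an edge into `S`. -/
noncomputable def inBoundary (E : V → V → Prop) (S : Finset V) : Finset V :=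
  outBoundary (fun a b => E b a) S

lemma mem_inBoundary {S : Finset V} {v : V} :
    v ∈ inBoundary E S ↔ v ∉ S ∧ ∃ u ∈ S, E v u := by
  simp [inBoundary, outBoundary]

lemma inBoundary_card_ge_of_compl [Nontrivial V] {S : Finset V}
    (h : 2 * Sᶜ.card ≤ Fintype.card V) :
    phiOut E * Sᶜ.card ≤ 3 * (inBoundary E S).card := by
  have hsub : inBoundary E S ⊆ Sᶜ := fun v hv => by
    simpa using (mem_inBoundary.1 hv).1
  have hsplit := Finset.card_sdiff_add_card_eq_card hsub
  have h2 := phiOut_le_two E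
  have hsplit' : ((Sᶜ \ inBoundary E S).card : ℝ) + (inBoundary E S).card = Sᶜ.card := by
    exact_mod_cast hsplit
  have hnn : (0 : ℝ) ≤ (inBoundary E S).card := by positivity
  rcases (Sᶜ \ inBoundary E S).eq_empty_or_nonempty with he | hne
  · rw [he] at hsplit'
    simp only [Finset.card_empty, Nat.cast_zero, zero_add] at hsplit'
    rw [← hsplit']
    nlinarith
  · have h1 := phiOut_mul_card_le E hne (by omega)
    have hb : outBoundary E (Sᶜ \ inBoundary E S) ⊆ inBoundary E S := by
      intro v hv
      obtain ⟨-, hv1, u, hu, huv⟩ := Finset.mem_filter.1 hv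
      rw [Finset.mem_sdiff, Finset.mem_compl, mem_inBoundary] at hu
      rw [Finset.mem_sdiff, Finset.mem_compl] at hv1
      by_contra hv2
      exact hv1 ⟨fun hvS => hu.2 ⟨hu.1, v, hvS, huv⟩, hv2⟩
    have h3 : ((outBoundary E (Sᶜ \ inBoundary E S)).card : ℝ) ≤ (inBoundary E S).card := by
      exact_mod_cast Finset.card_le_card hb
    rw [← hsplit', mul_add]
    nlinarith

/-- A bound on the expected time for a stable set of `i` vertices to acquire another vertex. -/
noncomputable def growthStep (φ : ℝ) (n i : ℕ) : ℝ :=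
  3 * n / φ * (1 / i + 1 / ((n : ℝ) - i))

lemma growthStep_nonneg {φ : ℝ} (hφ : 0 < φ) {n i : ℕ} (h : i ≤ n) :
    0 ≤ growthStep φ n i := by
  have : (0 : ℝ) ≤ (n : ℝ) - i := by
    rw [sub_nonneg]
    exact_mod_cast h
  unfold growthStep
  positivity

lemma card_le_inBoundary_mul_growthStep [Nontrivial V]
    (hE : ∀ u v : V, Relation.ReflTransGen E u v) {S : Finset V} (hS : S.Nonempty)
    (hS' : S ≠ Finset.univ) :
    (Fintype.card V : ℝ) ≤ (inBoundary E S).card *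
      growthStep (min (phiOut E) (phiIn E)) (Fintype.card V) S.card := by
  set n := Fintype.card V with hn
  set φ := min (phiOut E) (phiIn E) with hφdef
  have hφ : 0 < φ :=
    lt_min (phiOut_pos hE) (phiOut_pos fun u v => Relation.ReflTransGen.swap _ _ (hE v u))
  have hs : (0 : ℝ) < S.card := by exact_mod_cast hS.card_pos
  have hlt : S.card < n := by
    rw [hn, ← Finset.card_univ]
    exact Finset.card_lt_card ((Finset.subset_univ _).ssubset_of_ne hS')
  have hs' : (0 : ℝ) < (n : ℝ) - S.card := by
    rw [sub_pos]
    exact_mod_cast hlt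
  have hn0 : (0 : ℝ) < n := by linarith
  have key : ∃ k : ℝ, 0 < k ∧ φ * k ≤ 3 * (inBoundary E S).card ∧
      1 / k ≤ 1 / S.card + 1 / ((n : ℝ) - S.card) := by
    by_cases h : 2 * S.card ≤ n
    · refine ⟨S.card, hs, ?_, ?_⟩
      · have h1 : phiIn E * S.card ≤ (inBoundary E S).card := phiOut_mul_card_le _ hS h
        have h2 : φ * S.card ≤ phiIn E * S.card :=
          mul_le_mul_of_nonneg_right (min_le_right _ _) hs.le
        have h3 : (0 : ℝ) ≤ (inBoundary E S).card := by positivity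
        linarith
      · have : 0 < 1 / ((n : ℝ) - S.card) := by positivity
        linarith
    · have hcc : (Sᶜ.card : ℝ) = n - S.card := by
        rw [Finset.card_compl, Nat.cast_sub hlt.le]
      refine ⟨n - S.card, hs', ?_, ?_⟩
      · rw [← hcc]
        refine le_trans ?_ (inBoundary_card_ge_of_compl
          (by rw [Finset.card_compl]; omega))
        exact mul_le_mul_of_nonneg_right (min_le_left _ _) (by positivity)
      · have : 0 < 1 / (S.card : ℝ) := by positivity
        linarith
  obtain ⟨k, hk, hk1, hk2⟩ := key
  unfold growthStep
  calc (n : ℝ) = φ * k * (n / φ * (1 / k)) := by field_simp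
    _ ≤ 3 * (inBoundary E S).card * (n / φ * (1 / S.card + 1 / ((n : ℝ) - S.card))) := by
        gcongr
    _ = _ := by ring

lemma sum_growthStep_le {φ : ℝ} (hφ : 0 < φ) {n : ℕ} (hn : 2 ≤ n) :
    ∑ i ∈ Finset.Ico 1 n, growthStep φ n i ≤ 18 * (n / φ * Real.log n) := by
  have hrefl : ∑ i ∈ Finset.Ico 1 n, 1 / ((n : ℝ) - i) =
      ∑ i ∈ Finset.Ico 1 n, 1 / (i : ℝ) := by
    refine Finset.sum_nbij' (fun i => n - i) (fun i => n - i) ?_ ?_ ?_ ?_ ?_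
    · intro i hi
      rw [Finset.mem_Ico] at hi ⊢
      omega
    · intro i hi
      rw [Finset.mem_Ico] at hi ⊢
      omega
    · intro i hi
      rw [Finset.mem_Ico] at hi
      omega
    · intro i hi
      rw [Finset.mem_Ico] at hi
      omega
    · intro i hi
      rw [Finset.mem_Ico] at hi
      rw [Nat.cast_sub (by omega)]
  have hharm : ∑ i ∈ Finset.Ico 1 n, 1 / (i : ℝ) ≤ 1 + Real.log n := by
    refine le_trans ?_ (harmonic_le_one_add_log n)
    rw [harmonic_eq_sum_Icc]
    push_cast
    simp_rw [one_div]
    refine Finset.sum_le_sum_of_subset_of_nonneg ?_ fun _ _ _ => by positivity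
    intro i hi
    rw [Finset.mem_Ico] at hi
    rw [Finset.mem_Icc]
    omega
  have hlog : 1 / 2 ≤ Real.log n := by
    have h1 : Real.log 2 ≤ Real.log n :=
      Real.log_le_log (by norm_num) (by exact_mod_cast hn)
    have := Real.log_two_gt_d9
    linarith
  have hc : 0 ≤ 3 * (n : ℝ) / φ := by positivity
  unfold growthStep
  rw [← Finset.mul_sum, Finset.sum_add_distrib, hrefl]
  calc _ ≤ 3 * (n : ℝ) / φ * (6 * Real.log n) :=
        mul_le_mul_of_nonneg_left (by linarith) hc
    _ = _ := by ring

end Expansion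

section Drift

variable {V : Type*} [Fintype V] {E : V → V → Prop} {f : V → ℕ} {M : ℕ}

lemma dUpdate_of_ne {u v : V} (h : u ≠ v) : dUpdate E f v u = f u := by
  simp [dUpdate, h]

lemma dUpdate_le (hM : ∀ u, f u ≤ M) (v u : V) : dUpdate E f v u ≤ M := by
  unfold dUpdate
  split_ifs
  · exact Finset.sup_le fun w _ => hM w
  · exact hM u

lemma dUpdate_self_of_edge (hM : ∀ u, f u ≤ M) {v w : V} (h : E v w) (hw : f w = M) :
    dUpdate E f v v = M := by
  have hmem : w ∈ outNbrs E v := by simp [outNbrs, h]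
  refine (dUpdate_le hM v v).antisymm ?_
  rw [dUpdate, if_pos ⟨rfl, w, hmem⟩, ← hw]
  exact Finset.le_sup hmem

lemma truncTime_succ_le (m : ℕ) (f : V → ℕ) :
    truncTime E (m + 1) f ≤
      1 + (∑ v, truncTime E m (dUpdate E f v)) / Fintype.card V := by
  rw [truncTime_succ]
  gcongr
  unfold probNonconst
  split_ifs <;> simp

lemma truncTime_const [Nonempty V] (m : ℕ) (hM : ∀ u, f u = M)
    (hE : ∀ v, ∃ u, E v u) : truncTime E m f = 0 := by
  induction m generalizing f with
  | zero => simp [truncTime]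
  | succ m ih =>
    have h0 : probNonconst E 0 f = 0 := if_pos ⟨M, funext hM⟩
    have h1 : ∀ v, truncTime E m (dUpdate E f v) = 0 := fun v => ih fun u => by
      by_cases h : u = v
      · subst h
        obtain ⟨w, hw⟩ := hE u
        exact dUpdate_self_of_edge (fun u => (hM u).le) hw (hM w)
      · rw [dUpdate_of_ne h, hM]
    rw [truncTime_succ, h0]
    simp [h1]

/-- Once the maximal value occupies a set in which every vertex has an out-neighbour, this set
only grows, at a speed controlled by the vertex expansion. -/
lemma truncTime_le_of_stable [Nontrivial V]
    (hE : ∀ u v : V, Relation.ReflTransGen E u v) (m : ℕ) (f : V → ℕ) (hM : ∀ u, f u ≤ M)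
    (S : Finset V) (hne : S.Nonempty) (hS : ∀ u ∈ S, f u = M)
    (hst : ∀ u ∈ S, ∃ w ∈ S, E u w) :
    truncTime E m f ≤ ∑ i ∈ Finset.Ico S.card (Fintype.card V),
      growthStep (min (phiOut E) (phiIn E)) (Fintype.card V) i := by
  have hφ : 0 < min (phiOut E) (phiIn E) :=
    lt_min (phiOut_pos hE) (phiOut_pos fun u v => Relation.ReflTransGen.swap _ _ (hE v u))
  set n := Fintype.card V with hn
  have hn0 : (0 : ℝ) < n := by exact_mod_cast Fintype.card_pos
  set Ψ : ℕ → ℝ := fun s => ∑ i ∈ Finset.Ico s n,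
    growthStep (min (phiOut E) (phiIn E)) n i with hΨ
  induction m generalizing f S with
  | zero =>
    simp only [truncTime, Finset.range_zero, Finset.sum_empty]
    exact Finset.sum_nonneg fun i hi => growthStep_nonneg hφ (Finset.mem_Ico.1 hi).2.le
  | succ m ih =>
    by_cases hS' : S = Finset.univ
    · subst hS'
      rw [truncTime_const _ (fun u => hS u (Finset.mem_univ u)) (exists_edge hE)]
      exact Finset.sum_nonneg fun i hi => growthStep_nonneg hφ (Finset.mem_Ico.1 hi).2.le
    have hlt : S.card < n := by
      rw [hn, ← Finset.card_univ]
      exact Finset.card_lt_card ((Finset.subset_univ _).ssubset_of_ne hS')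
    set w := growthStep (min (phiOut E) (phiIn E)) n S.card with hw
    have hΨs : Ψ S.card = w + Ψ (S.card + 1) := Finset.sum_eq_sum_Ico_succ_bot hlt _
    have hS1 : ∀ v, ∀ u ∈ S, dUpdate E f v u = M := fun v u hu => by
      by_cases h : u = v
      · subst h
        obtain ⟨z, hz, huz⟩ := hst u hu
        exact dUpdate_self_of_edge hM huz (hS z hz)
      · rw [dUpdate_of_ne h, hS u hu]
    have hstep : ∀ v, truncTime E m (dUpdate E f v) ≤
        Ψ S.card - if v ∈ inBoundary E S then w else 0 := by
      intro v
      split_ifs with hv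
      · obtain ⟨hvS, z, hz, hvz⟩ := mem_inBoundary.1 hv
        rw [hΨs, add_sub_cancel_left, ← Finset.card_insert_of_notMem hvS]
        refine ih _ (dUpdate_le hM v) _ (Finset.insert_nonempty _ _) ?_ ?_
        · intro u hu
          rcases Finset.mem_insert.1 hu with rfl | hu
          · exact dUpdate_self_of_edge hM hvz (hS z hz)
          · exact hS1 v u hu
        · intro u hu
          rcases Finset.mem_insert.1 hu with rfl | hu
          · exact ⟨z, Finset.mem_insert_of_mem hz, hvz⟩
          · obtain ⟨y, hy, huy⟩ := hst u hu
            exact ⟨y, Finset.mem_insert_of_mem hy, huy⟩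
      · rw [sub_zero]
        exact ih _ (dUpdate_le hM v) _ hne (hS1 v) hst
    have hsum := Finset.sum_le_sum fun v (_ : v ∈ Finset.univ) => hstep v
    rw [Finset.sum_sub_distrib, Finset.sum_const, Finset.card_univ, ← hn, nsmul_eq_mul,
      Finset.sum_ite_mem, Finset.univ_inter, Finset.sum_const, nsmul_eq_mul] at hsum
    have hgrow : (n : ℝ) ≤ (inBoundary E S).card * w :=
      card_le_inBoundary_mul_growthStep hE hne hS'
    refine (truncTime_succ_le m f).trans ?_
    rw [← hn, ← le_sub_iff_add_le', div_le_iff₀ hn0]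
    change _ ≤ (Ψ S.card - 1) * n
    linarith

/-- Along a directed cycle that is properly met by the set of maximal vertices, the squared size
of the intersection increases on average. -/
lemma sum_sq_card_max_ge {C : Finset V} {σ : Equiv.Perm V} (hC : IsOrientedCycle E C σ)
    (hM : ∀ u, f u ≤ M) (h0 : (C.filter fun c => f c = M).Nonempty)
    (h1 : (C.filter fun c => f c = M) ≠ C) :
    (Fintype.card V : ℝ) * ((C.filter fun c => f c = M).card : ℝ) ^ 2 + 2 ≤
      ∑ v, ((C.filter fun c => dUpdate E f v c = M).card : ℝ) ^ 2 := by
  set B := C.filter fun c => f c = M with hB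
  set A := Finset.univ.filter fun c => f c = M with hA
  have hAB : (C.filter fun c => c ∈ A) = B := by simp [hA, hB]
  set U := C.filter fun c => c ∉ A ∧ σ c ∈ A with hU
  set D := C.filter fun c => c ∈ A ∧ σ c ∉ A with hD
  have hUD : U.card = D.card := hC.card_enter_eq_card_leave A
  have hDpos : 0 < D.card := hC.card_leave_pos (by rwa [hAB]) (by rwa [hAB])
  set a : ℝ := (B.card : ℝ) with ha
  have ha1 : 1 ≤ a := by
    rw [ha]
    exact_mod_cast h0.card_pos
  have hpt : ∀ v, a ^ 2 + (if v ∈ U then 2 * a + 1 else 0) -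
      (if v ∈ D then 2 * a - 1 else 0) ≤
        ((C.filter fun c => dUpdate E f v c = M).card : ℝ) ^ 2 := by
    intro v
    set B' := C.filter fun c => dUpdate E f v c = M with hB'
    have hsub : B.erase v ⊆ B' := fun c hc => by
      obtain ⟨hcv, hc⟩ := Finset.mem_erase.1 hc
      obtain ⟨hcC, hcM⟩ := Finset.mem_filter.1 hc
      exact Finset.mem_filter.2 ⟨hcC, by rw [dUpdate_of_ne hcv, hcM]⟩
    have hkeep : v ∈ C → σ v ∈ A → v ∈ B' := fun hv hσ =>
      Finset.mem_filter.2 ⟨hv, dUpdate_self_of_edge hM (hC.edge v hv) (by simpa [hA] using hσ)⟩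
    by_cases hvU : v ∈ U
    · obtain ⟨hvC, hvA, hσ⟩ := Finset.mem_filter.1 hvU
      have hvB : v ∉ B := fun h => hvA (by simpa [hA] using (Finset.mem_filter.1 h).2)
      have hvD : v ∉ D := fun h => hvA (Finset.mem_filter.1 h).2.1
      rw [Finset.erase_eq_of_notMem hvB] at hsub
      have h := Finset.card_le_card (Finset.insert_subset (hkeep hvC hσ) hsub)
      rw [Finset.card_insert_of_notMem hvB] at h
      have h' : a + 1 ≤ B'.card := by
        rw [ha]
        exact_mod_cast h
      rw [if_pos hvU, if_neg hvD]
      nlinarith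
    · rw [if_neg hvU]
      by_cases hvD : v ∈ D
      · rw [if_pos hvD]
        have h := (Finset.pred_card_le_card_erase (s := B) (a := v)).trans
          (Finset.card_le_card hsub)
        have h' : a ≤ B'.card + 1 := by
          rw [ha]
          exact_mod_cast (by omega : B.card ≤ B'.card + 1)
        nlinarith
      · rw [if_neg hvD]
        have hBB : B ⊆ B' := fun c hc => by
          by_cases hcv : c = v
          · subst hcv
            obtain ⟨hcC, hcM⟩ := Finset.mem_filter.1 hc
            have hcA : c ∈ A := by simpa [hA] using hcM
            by_cases hσ : σ c ∈ A
            · exact hkeep hcC hσ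
            · exact absurd (Finset.mem_filter.2 ⟨hcC, hcA, hσ⟩) hvD
          · exact hsub (Finset.mem_erase.2 ⟨hcv, hc⟩)
        have h' : a ≤ B'.card := by
          rw [ha]
          exact_mod_cast Finset.card_le_card hBB
        nlinarith
  refine le_trans ?_ (Finset.sum_le_sum fun v _ => hpt v)
  rw [Finset.sum_sub_distrib, Finset.sum_add_distrib, Finset.sum_const, Finset.card_univ,
    nsmul_eq_mul, Finset.sum_ite_mem, Finset.sum_ite_mem, Finset.univ_inter,
    Finset.univ_inter, Finset.sum_const, Finset.sum_const, nsmul_eq_mul, nsmul_eq_mul, hUD]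
  have hD1 : (1 : ℝ) ≤ D.card := by exact_mod_cast hDpos
  nlinarith

lemma truncTime_le_of_cycle [Nontrivial V]
    (hE : ∀ u v : V, Relation.ReflTransGen E u v) (m : ℕ) (f : V → ℕ) (M : ℕ)
    (hM : ∀ u, f u ≤ M) (C : Finset V) (σ : Equiv.Perm V) (hC : IsOrientedCycle E C σ)
    (hb : C.card ≤ orbit E) :
    truncTime E m f ≤ ∑ i ∈ Finset.Ico 1 (Fintype.card V),
        growthStep (min (phiOut E) (phiIn E)) (Fintype.card V) i +
      Fintype.card V * ((orbit E : ℝ) ^ 2 - ((C.filter fun c => f c = M).card : ℝ) ^ 2) / 2 := by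
  have hφ : 0 < min (phiOut E) (phiIn E) :=
    lt_min (phiOut_pos hE) (phiOut_pos fun u v => Relation.ReflTransGen.swap _ _ (hE v u))
  set n := Fintype.card V with hn
  have hn0 : (0 : ℝ) < n := by exact_mod_cast Fintype.card_pos
  have hg : ∀ i ∈ Finset.Ico 1 n, 0 ≤ growthStep (min (phiOut E) (phiIn E)) n i :=
    fun i hi => growthStep_nonneg hφ (Finset.mem_Ico.1 hi).2.le
  set Ψ := ∑ i ∈ Finset.Ico 1 n, growthStep (min (phiOut E) (phiIn E)) n i with hΨ
  have hΨ0 : 0 ≤ Ψ := Finset.sum_nonneg hg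
  have hcycle : ∀ {D T : Finset V}, D.card ≤ orbit E → T ⊆ D →
      0 ≤ n * ((orbit E : ℝ) ^ 2 - (T.card : ℝ) ^ 2) / 2 := by
    intro D T hD hT
    have : (T.card : ℝ) ≤ orbit E := by
      exact_mod_cast (Finset.card_le_card hT).trans hD
    have : (0 : ℝ) ≤ (orbit E : ℝ) ^ 2 - (T.card : ℝ) ^ 2 := by
      rw [sub_nonneg]
      gcongr
    positivity
  induction m generalizing f M C σ with
  | zero =>
    simp only [truncTime, Finset.range_zero, Finset.sum_empty]
    exact add_nonneg hΨ0 (hcycle hb (Finset.filter_subset _ _))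
  | succ m ih =>
    -- It suffices to consider cycles meeting the set of maximal vertices.
    have main : ∀ (M : ℕ) (_ : ∀ u, f u ≤ M) (C : Finset V) (σ : Equiv.Perm V)
        (_ : IsOrientedCycle E C σ) (_ : C.card ≤ orbit E)
        (_ : (C.filter fun c => f c = M).Nonempty),
        truncTime E (m + 1) f ≤ Ψ +
          n * ((orbit E : ℝ) ^ 2 - ((C.filter fun c => f c = M).card : ℝ) ^ 2) / 2 := by
      intro M hM C σ hC hb h0
      by_cases h1 : (C.filter fun c => f c = M) = C
      · refine le_trans ?_ (le_add_of_nonneg_right (hcycle hb (Finset.filter_subset _ _)))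
        rw [h1] at h0
        refine (truncTime_le_of_stable hE (m + 1) f hM C h0
          (fun u hu => ?_) fun u hu => ⟨σ u, hC.mem u hu, hC.edge u hu⟩).trans ?_
        · rw [← h1] at hu
          exact (Finset.mem_filter.1 hu).2
        · refine Finset.sum_le_sum_of_subset_of_nonneg
            (Finset.Ico_subset_Ico_left h0.card_pos) fun i hi _ => hg i hi
      · have hsum := Finset.sum_le_sum fun v (_ : v ∈ Finset.univ) =>
          ih (dUpdate E f v) M (dUpdate_le hM v) C σ hC hb
        have hsq := sum_sq_card_max_ge hC hM h0 h1
        rw [Finset.sum_add_distrib, ← Finset.sum_div, ← Finset.mul_sum,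
          Finset.sum_sub_distrib, Finset.sum_const, Finset.sum_const, Finset.card_univ, ← hn,
          nsmul_eq_mul, nsmul_eq_mul] at hsum
        rw [← hn] at hsq
        refine (truncTime_succ_le m f).trans ?_
        rw [← hn, ← le_sub_iff_add_le', div_le_iff₀ hn0]
        refine hsum.trans ?_
        nlinarith
    rcases (C.filter fun c => f c = M).eq_empty_or_nonempty with he | hne
    · obtain ⟨x, hx⟩ := Finite.exists_max f
      obtain ⟨C', σ', hC', hxC', hb'⟩ := exists_isOrientedCycle hE x
      refine (main (f x) hx C' σ' hC' hb' ⟨x, by simp [hxC']⟩).trans ?_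
      rw [he]
      gcongr
      simp
    · exact main M hM C σ hC hb hne

end Drift

/-- there is a constant `C > 0` such that for every finite strongly connected
directed graph on `n ≥ 2` vertices with orbit `b` and `φ' = min(φ_out, φ_in)`, and every
valuation `f : V → {1,…,n}`, the expected convergence time of the asynchronous maximum model
satisfies `T(G,f) ≤ C·(n·b² + (n/φ')·log n)`.  In particular
`𝒯(G) = O(n·b² + (n/φ')·log n)`. -/
theorem expected_dConvTime_le :
    ∃ C : ℝ, 0 < C ∧
      ∀ (V : Type) [Fintype V] [MeasurableSpace V] [MeasurableSingletonClass V]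
        (E : V → V → Prop) (n : ℕ), 2 ≤ n → Fintype.card V = n →
        (∀ u v : V, Relation.ReflTransGen E u v) →
        ∀ (f : V → ℕ), (∀ v, f v ∈ Finset.Icc 1 n) →
        ∀ (μ : Measure (ℕ → V)), IsUniformProduct μ →
          ∫⁻ ω, dConvTime E f ω ∂μ ≤
            ENNReal.ofReal (C * ((n : ℝ) * (orbit E : ℝ) ^ 2 +
              ((n : ℝ) / min (phiOut E) (phiIn E)) * Real.log n)) := by
  refine ⟨18, by norm_num, ?_⟩
  rintro V _ _ _ E n hn rfl hE f - μ hμ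
  have : Nontrivial V := Fintype.one_lt_card_iff_nontrivial.1 hn
  have hφ : 0 < min (phiOut E) (phiIn E) :=
    lt_min (phiOut_pos hE) (phiOut_pos fun u v => Relation.ReflTransGen.swap _ _ (hE v u))
  refine lintegral_dConvTime_le E hμ fun m => ?_
  obtain ⟨x, hx⟩ := Finite.exists_max f
  obtain ⟨C, σ, hC, -, hb⟩ := exists_isOrientedCycle hE x
  have h1 := truncTime_le_of_cycle hE m f (f x) hx C σ hC hb
  have h2 := sum_growthStep_le hφ hn
  have h3 : 0 ≤ (Fintype.card V : ℝ) * (orbit E : ℝ) ^ 2 := by positivity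
  have h4 : 0 ≤ (Fintype.card V : ℝ) *
      ((C.filter fun c => f c = f x).card : ℝ) ^ 2 := by positivity
  linarith
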